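/- arXiv:2312.15214 — 2 statements merged into one kernel-verified Lean document; each statement's English description precedes it below -/
import Mathlib

section
/- Let k ≥ 2, n ≥ 1, and let s = (s_1,…,s_n), s' = (s'_1,…,s'_n) ∈ ℤ^n with gcd(s_i,k) = 1 and gcd(s'_i,k) = 1 for all i. Then the cyclic subgroups Γ_{k,s} and Γ_{k,s'} of U(n) are conjugate in U(n) (that is, A·Γ_{k,s}·A⁻¹ = Γ_{k,s'} for some A ∈ U(n)) if and only if there exist a permutation σ of {1,…,n} and an integer c with gcd(c,k) = 1 such that s_i ≡ c·s'_{σ(i)} (mod k) for all i = 1,…,n. -/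
open Matrix Complex

noncomputable section

/-- The standard primitive `k`-th root of unity `ξ_k = exp(2πi/k)`. -/
def xi (k : ℕ) : ℂ := Complex.exp (2 * Real.pi * Complex.I / k)

lemma xi_ne_zero (k : ℕ) : xi k ≠ 0 := Complex.exp_ne_zero _

lemma star_xi (k : ℕ) : (starRingEnd ℂ) (xi k) = (xi k)⁻¹ := by
  rw [xi, ← Complex.exp_conj, ← Complex.exp_neg]
  congr 1
  rw [map_div₀, _root_.map_mul, _root_.map_mul, Complex.conj_I]
  simp [Complex.conj_ofReal, map_ofNat]
  ring

/-- The generator `γ_{k,s} = diag(ξ_k^{s_1}, …, ξ_k^{s_n})` of a lens group. -/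
def lensGen (n : ℕ) (k : ℕ) (s : Fin n → ℤ) : Matrix (Fin n) (Fin n) ℂ :=
  Matrix.diagonal fun i => xi k ^ (s i)

lemma lensGen_mem (n k : ℕ) (s : Fin n → ℤ) :
    lensGen n k s ∈ Matrix.unitaryGroup (Fin n) ℂ := by
  rw [Matrix.mem_unitaryGroup_iff]
  have hstar : star (lensGen n k s) = Matrix.diagonal fun i => star (xi k ^ (s i)) := by
    rw [lensGen, Matrix.star_eq_conjTranspose, Matrix.diagonal_conjTranspose]
    rfl
  rw [hstar, lensGen, Matrix.diagonal_mul_diagonal]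
  convert Matrix.diagonal_one
  rename_i i
  have : (starRingEnd ℂ) (xi k ^ (s i)) = (xi k ^ (s i))⁻¹ := by
    rw [map_zpow₀, star_xi, _root_.inv_zpow]
  rw [RCLike.star_def, this, mul_inv_cancel₀ (zpow_ne_zero _ (xi_ne_zero k))]

/-- The cyclic subgroup `Γ_{k,s}` of `U(n)` generated by `γ_{k,s}`. -/
def lensSubgroup (n k : ℕ) (s : Fin n → ℤ) : Subgroup (Matrix.unitaryGroup (Fin n) ℂ) :=
  Subgroup.zpowers ⟨lensGen n k s, lensGen_mem n k s⟩

lemma exists_perm_of_map_univ_eq {ι α : Type*} [Fintype ι] {f g : ι → α}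
    (h : (Finset.univ : Finset ι).val.map f = (Finset.univ : Finset ι).val.map g) :
    ∃ σ : Equiv.Perm ι, ∀ i, f i = g (σ i) := by
  classical
  have e : ∀ a, Nonempty ({i // f i = a} ≃ {i // g i = a}) := fun a => by
    rw [← Fintype.card_eq, Fintype.card_subtype, Fintype.card_subtype]
    have h1 := congrArg (Multiset.count a) h
    simp only [Multiset.count_map, eq_comm (a := a)] at h1
    exact h1
  exact ⟨Equiv.ofFiberEquiv fun a => (e a).some, fun i => (Equiv.ofFiberEquiv_map _ i).symm⟩

lemma exists_perm_of_diagonal_conj {n R : Type*} [Fintype n] [DecidableEq n] [CommRing R]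
    [IsDomain R] {f g : n → R} (A : (Matrix n n R)ˣ)
    (h : (A : Matrix n n R) * diagonal f * (A⁻¹ : (Matrix n n R)ˣ) = diagonal g) :
    ∃ σ : Equiv.Perm n, ∀ i, f i = g (σ i) := by
  apply exists_perm_of_map_univ_eq
  have hc := Matrix.charpoly_units_conj A (diagonal f)
  rw [← coe_units_inv, h, charpoly_diagonal, charpoly_diagonal] at hc
  have key : ∀ d : n → R, (∏ i, (Polynomial.X - Polynomial.C (d i))).roots =
      Finset.univ.val.map d := fun d => by
    rw [← Polynomial.roots_multiset_prod_X_sub_C (Finset.univ.val.map d), Multiset.map_map]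
    rfl
  rw [← key, ← key, hc]

lemma permMatrix_mem_unitaryGroup {n R : Type*} [Fintype n] [DecidableEq n] [CommRing R]
    [StarRing R] (σ : Equiv.Perm n) : σ.permMatrix R ∈ Matrix.unitaryGroup n R := by
  rw [Matrix.mem_unitaryGroup_iff, star_eq_conjTranspose, conjTranspose_permMatrix,
    ← permMatrix_mul, inv_mul_cancel, permMatrix_one]

lemma permMatrix_inv_mul_diagonal {n R : Type*} [Fintype n] [DecidableEq n] [CommRing R]
    (σ : Equiv.Perm n) (g : n → R) :
    (σ⁻¹).permMatrix R * diagonal (fun i => g (σ i)) = diagonal g * (σ⁻¹).permMatrix R := by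
  rw [PEquiv.toMatrix_toPEquiv_mul, PEquiv.mul_toMatrix_toPEquiv]
  ext i j
  by_cases h : i = σ j
  · subst h
    simp [Equiv.Perm.inv_def]
  · have h' : σ⁻¹ i ≠ j := fun e => h (by simp [← e])
    simp_all [Equiv.Perm.inv_def]

lemma xi_isPrimitiveRoot {k : ℕ} (hk : k ≠ 0) : IsPrimitiveRoot (xi k) k :=
  Complex.isPrimitiveRoot_exp k hk

lemma xi_zpow_eq_iff {k : ℕ} (hk : k ≠ 0) (a b : ℤ) :
    xi k ^ a = xi k ^ b ↔ (k : ℤ) ∣ a - b := by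
  rw [← (xi_isPrimitiveRoot hk).zpow_eq_one_iff_dvd, zpow_sub₀ (xi_ne_zero k),
    div_eq_one_iff_eq (zpow_ne_zero _ (xi_ne_zero k))]

/-- `γ_{k,s}` as an element of `U(n)`. -/
def lensUnitary (n k : ℕ) (s : Fin n → ℤ) : Matrix.unitaryGroup (Fin n) ℂ :=
  ⟨lensGen n k s, lensGen_mem n k s⟩

lemma lensUnitary_mul (n k : ℕ) (s t : Fin n → ℤ) :
    lensUnitary n k s * lensUnitary n k t = lensUnitary n k (s + t) := by
  apply Subtype.ext
  simp [lensUnitary, lensGen, diagonal_mul_diagonal, zpow_add₀ (xi_ne_zero k)]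

lemma lensUnitary_zpow (n k : ℕ) (s : Fin n → ℤ) (c : ℤ) :
    lensUnitary n k s ^ c = lensUnitary n k (c • s) := by
  let φ : Multiplicative (Fin n → ℤ) →* Matrix.unitaryGroup (Fin n) ℂ :=
    MonoidHom.mk' (fun t => lensUnitary n k t.toAdd) fun a b => (lensUnitary_mul n k _ _).symm
  exact (map_zpow φ (Multiplicative.ofAdd s) c).symm

lemma lensUnitary_eq_iff {n k : ℕ} (hk : k ≠ 0) (s t : Fin n → ℤ) :
    lensUnitary n k s = lensUnitary n k t ↔ ∀ i, (k : ℤ) ∣ s i - t i := by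
  simp_rw [← xi_zpow_eq_iff hk, ← funext_iff]
  exact Subtype.ext_iff.trans diagonal_injective.eq_iff

lemma map_conj_lensSubgroup (n k : ℕ) (s : Fin n → ℤ) (A : Matrix.unitaryGroup (Fin n) ℂ) :
    (lensSubgroup n k s).map (MulAut.conj A).toMonoidHom =
      Subgroup.zpowers (A * lensUnitary n k s * A⁻¹) :=
  MonoidHom.map_zpowers _ _

lemma zpowers_lensUnitary_zpow {n k : ℕ} (hk : k ≠ 0) (s : Fin n → ℤ) {c : ℤ}
    (hc : Int.gcd c k = 1) :
    Subgroup.zpowers (lensUnitary n k s ^ c) = lensSubgroup n k s := by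
  apply le_antisymm
  · exact Subgroup.zpowers_le.2 (Subgroup.zpow_mem_zpowers _ _)
  · refine Subgroup.zpowers_le.2 ⟨Int.gcdA c k, ?_⟩
    change (lensUnitary n k s ^ c) ^ Int.gcdA c k = lensUnitary n k s
    rw [← _root_.zpow_mul, lensUnitary_zpow, lensUnitary_eq_iff hk]
    intro i
    have hb := Int.gcd_eq_gcd_ab c k
    rw [hc] at hb
    refine ⟨-(Int.gcdB c k * s i), ?_⟩
    simp only [Pi.smul_apply, smul_eq_mul]
    push_cast at hb
    linear_combination (-s i) * hb

/-- **Conjugacy criterion for lens groups in `U(n)`.**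
`Γ_{k,s}` and `Γ_{k,s'}` are conjugate in `U(n)` iff there are a permutation `σ` and an
integer `c` coprime to `k` with `s_i ≡ c·s'_{σ(i)} (mod k)` for all `i`. -/
theorem lens_conjugate_iff (k n : ℕ) (hk : 2 ≤ k) (hn : 1 ≤ n)
    (s s' : Fin n → ℤ)
    (hs : ∀ i, Int.gcd (s i) k = 1) (hs' : ∀ i, Int.gcd (s' i) k = 1) :
    (∃ A : Matrix.unitaryGroup (Fin n) ℂ,
        Subgroup.map (MulAut.conj A).toMonoidHom (lensSubgroup n k s) = lensSubgroup n k s')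
      ↔ ∃ σ : Equiv.Perm (Fin n), ∃ c : ℤ, Int.gcd c k = 1 ∧
          ∀ i, (k : ℤ) ∣ (s i - c * s' (σ i)) := by
  have hk0 : k ≠ 0 := by omega
  constructor
  · rintro ⟨A, hA⟩
    rw [map_conj_lensSubgroup] at hA
    obtain ⟨c, hc⟩ : A * lensUnitary n k s * A⁻¹ ∈ lensSubgroup n k s' :=
      hA ▸ Subgroup.mem_zpowers _
    change lensUnitary n k s' ^ c = _ at hc
    rw [lensUnitary_zpow] at hc
    have hmat : (A : Matrix (Fin n) (Fin n) ℂ) * lensGen n k s *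
        (A⁻¹ : Matrix.unitaryGroup (Fin n) ℂ) = lensGen n k (c • s') :=
      (congrArg Subtype.val hc).symm
    obtain ⟨σ, hσ⟩ := exists_perm_of_diagonal_conj (Unitary.toUnits A) hmat
    have hdvd : ∀ i, (k : ℤ) ∣ s i - c * s' (σ i) := fun i => (xi_zpow_eq_iff hk0 _ _).1 (hσ i)
    refine ⟨σ, c, ?_, hdvd⟩
    rw [← Int.isCoprime_iff_gcd_eq_one]
    obtain ⟨m, hm⟩ := hdvd ⟨0, hn⟩
    have hs0 := Int.isCoprime_iff_gcd_eq_one.2 (hs ⟨0, hn⟩)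
    rw [sub_eq_iff_eq_add'.1 hm, IsCoprime.add_mul_left_left_iff] at hs0
    exact hs0.of_mul_left_left
  · rintro ⟨σ, c, hc, hdvd⟩
    let A : Matrix.unitaryGroup (Fin n) ℂ := ⟨(σ⁻¹).permMatrix ℂ, permMatrix_mem_unitaryGroup _⟩
    have hA : A * lensUnitary n k (fun i => (c • s') (σ i)) = lensUnitary n k (c • s') * A :=
      Subtype.ext (permMatrix_inv_mul_diagonal σ fun i => xi k ^ (c • s') i)
    refine ⟨A, ?_⟩
    rw [map_conj_lensSubgroup, ← zpowers_lensUnitary_zpow hk0 s' hc, lensUnitary_zpow,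
      (lensUnitary_eq_iff hk0 s fun i => (c • s') (σ i)).2 hdvd, hA,
      mul_inv_cancel_right]

end
end

section
/- Let k ≥ 2, n ≥ 1, and let s ∈ ℤ^n with gcd(s_i,k) = 1 for all i; write ξ = exp(2πi/k). Then for all complex numbers z, w with |z| < 1 and |w| < 1, the double series Σ_{p,q ≥ 0} d_{Γ_{k,s}}(p,q)·z^p·w^q converges absolutely and equals (1/k) · Σ_{m=0}^{k−1} (1 − zw) / Π_{i=1}^{n} ( (z − ξ^{−s_i·m})·(w − ξ^{s_i·m}) ). -/
open MvPolynomial Matrix Complex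

noncomputable section

/-- The polynomial ring `ℂ[z_1,…,z_n, z̄_1,…,z̄_n]`. -/
abbrev Rn (n : ℕ) := MvPolynomial (Fin n ⊕ Fin n) ℂ

/-- Weight assigning `(1,0)` to each `z_j` and `(0,1)` to each `z̄_j`. -/
def wt (n : ℕ) : (Fin n ⊕ Fin n) → ℕ × ℕ := Sum.elim (fun _ => (1, 0)) (fun _ => (0, 1))

/-- `𝒫_{p,q}`: polynomials homogeneous of degree `p` in `z` and `q` in `z̄`. -/
def Ppq (n p q : ℕ) : Submodule ℂ (Rn n) :=
  MvPolynomial.weightedHomogeneousSubmodule ℂ (wt n) (p, q)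

/-- `Δ = Σ_j ∂²/∂z_j∂z̄_j`. -/
def DeltaOp (n : ℕ) : Rn n →ₗ[ℂ] Rn n :=
  ∑ j : Fin n, (MvPolynomial.pderiv (Sum.inl j)).toLinearMap ∘ₗ (MvPolynomial.pderiv (Sum.inr j)).toLinearMap

/-- `ℋ_{p,q}`: harmonic polynomials of bidegree `(p,q)`. -/
def Hpq (n p q : ℕ) : Submodule ℂ (Rn n) :=
  Ppq n p q ⊓ LinearMap.ker (DeltaOp n)

/-- The action of a matrix `γ` on `R_n` by the algebra substitution
`z_i ↦ Σ_j (γ⁻¹)_{ij} z_j`, `z̄_i ↦ Σ_j conj((γ⁻¹)_{ij}) z̄_j`. -/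
def matAct (n : ℕ) (γ : Matrix (Fin n) (Fin n) ℂ) : Rn n →ₐ[ℂ] Rn n :=
  MvPolynomial.aeval (Sum.elim
    (fun i => ∑ j, (γ⁻¹ i j) • MvPolynomial.X (Sum.inl j))
    (fun i => ∑ j, (starRingEnd ℂ) (γ⁻¹ i j) • MvPolynomial.X (Sum.inr j)))

/-- The subspace of polynomials fixed by the action of `γ`. -/
def fixedBy (n : ℕ) (γ : Matrix (Fin n) (Fin n) ℂ) : Submodule ℂ (Rn n) :=
  LinearMap.ker ((matAct n γ).toLinearMap - LinearMap.id)

/-- `ℋ_{p,q}^Γ`, the `Γ`-invariant harmonic polynomials of bidegree `(p,q)`. -/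
def HpqInv (n p q : ℕ) (Γ : Subgroup (Matrix.unitaryGroup (Fin n) ℂ)) : Submodule ℂ (Rn n) :=
  Hpq n p q ⊓ ⨅ γ ∈ Γ, fixedBy n ↑γ

/-- `d_Γ(p,q) = dim_ℂ ℋ_{p,q}^Γ`. -/
def dInv (n p q : ℕ) (Γ : Subgroup (Matrix.unitaryGroup (Fin n) ℂ)) : ℕ :=
  Module.finrank ℂ (HpqInv n p q Γ)

/-- A subgroup of `U(n)` acts freely on `S^{2n-1}` iff no nontrivial element has `1` as an
eigenvalue. -/
def actsFreely (n : ℕ) (Γ : Subgroup (Matrix.unitaryGroup (Fin n) ℂ)) : Prop :=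
  ∀ γ ∈ Γ, γ ≠ 1 → ∀ v : Fin n → ℂ, (↑γ : Matrix (Fin n) (Fin n) ℂ).mulVec v = v → v = 0
theorem xi_zpow_eq_one_iff {k : ℕ} (hk : k ≠ 0) (c : ℤ) : xi k ^ c = 1 ↔ (k : ℤ) ∣ c :=
  (Complex.isPrimitiveRoot_exp k hk).zpow_eq_one_iff_dvd c

theorem sum_xi_zpow_mul {k : ℕ} (hk : k ≠ 0) (c : ℤ) :
    (k : ℂ)⁻¹ * ∑ m ∈ Finset.range k, xi k ^ (c * m) = if (k : ℤ) ∣ c then 1 else 0 := by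
  have hk' : (k : ℂ) ≠ 0 := Nat.cast_ne_zero.mpr hk
  simp_rw [_root_.zpow_mul, zpow_natCast]
  split_ifs with h
  · rw [(xi_zpow_eq_one_iff hk c).mpr h]
    simp [hk']
  · have hne : xi k ^ c ≠ 1 := fun h' => h ((xi_zpow_eq_one_iff hk c).mp h')
    have hone : (xi k ^ c) ^ k = 1 := by
      rw [← zpow_natCast, ← _root_.zpow_mul, xi_zpow_eq_one_iff hk]
      exact dvd_mul_left _ _
    rw [geom_sum_eq hne, hone]
    simp

theorem norm_xi_zpow {k : ℕ} (hk : k ≠ 0) (c : ℤ) : ‖xi k ^ c‖ = 1 := by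
  have h : ‖xi k‖ = 1 := (Complex.isPrimitiveRoot_exp k hk).norm'_eq_one hk
  rw [norm_zpow, h, _root_.one_zpow]

theorem hasSum_mul_complex {α β : Type*} {f : α → ℂ} {g : β → ℂ} {a b : ℂ} (hf : HasSum f a)
    (hg : HasSum g b) : HasSum (fun x : α × β => f x.1 * g x.2) (a * b) :=
  hf.mul hg (summable_mul_of_summable_norm hf.summable.norm hg.summable.norm)

/-- The product of finitely many absolutely convergent series. -/
theorem hasSum_pi_prod {κ : Type*} {n : ℕ} {f : Fin n → κ → ℂ} {a : Fin n → ℂ}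
    (hf : ∀ i, HasSum (f i) (a i)) :
    HasSum (fun x : Fin n → κ => ∏ i, f i (x i)) (∏ i, a i) := by
  induction n with
  | zero => simp [hasSum_unique]
  | succ n ih =>
    have ih' := ih fun i => hf i.succ
    have hprod := hasSum_mul_complex (hf 0) ih'
    rw [← (Fin.consEquiv fun _ : Fin (n + 1) => κ).hasSum_iff, Fin.prod_univ_succ]
    convert! hprod using 2 with x
    simp [Fin.prod_univ_succ, Fin.consEquiv]

/-- The weight under which a monomial is scaled by `ξ ^ (-weight)` under `γ_{k,s}`. -/
def charge {n : ℕ} (s : Fin n → ℤ) : Fin n ⊕ Fin n → ℤ := Sum.elim s (-s)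

/-- Exponents of the `Γ_{k,s}`-invariant monomials of a given bidegree. -/
def invExponents (n k : ℕ) (s : Fin n → ℤ) (d : ℕ × ℕ) : Set (Fin n ⊕ Fin n →₀ ℕ) :=
  {x | Finsupp.weight (wt n) x = d ∧ (k : ℤ) ∣ Finsupp.weight (charge s) x}

theorem weight_wt {n : ℕ} (x : Fin n ⊕ Fin n →₀ ℕ) :
    Finsupp.weight (wt n) x = (∑ i, x (Sum.inl i), ∑ i, x (Sum.inr i)) := by
  rw [Finsupp.weight_eq_sum, Fintype.sum_sum_type]
  ext <;> simp [wt, Prod.fst_sum, Prod.snd_sum]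

theorem weight_charge {n : ℕ} (s : Fin n → ℤ) (x : Fin n ⊕ Fin n →₀ ℕ) :
    Finsupp.weight (charge s) x =
      ∑ i, s i * x (Sum.inl i) - ∑ i, s i * x (Sum.inr i) := by
  rw [Finsupp.weight_eq_sum, Fintype.sum_sum_type]
  simp [charge, sub_eq_add_neg, mul_comm]

theorem finite_invExponents (n k : ℕ) (s : Fin n → ℤ) (d : ℕ × ℕ) :
    (invExponents n k s d).Finite := by
  refine (Finsupp.finite_of_degree_le (σ := Fin n ⊕ Fin n) (d.1 + d.2)).subset ?_
  rintro x ⟨rfl, -⟩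
  simp [weight_wt, Finsupp.degree_eq_sum]

theorem coeff_aeval_smul_X {σ : Type*} [Fintype σ] (c : σ → ℂ) (P : MvPolynomial σ ℂ)
    (x : σ →₀ ℕ) :
    coeff x (aeval (fun v => c v • (X v : MvPolynomial σ ℂ)) P) =
      (∏ v, c v ^ x v) * coeff x P := by
  classical
  induction P using MvPolynomial.induction_on' with
  | monomial y a =>
    have h : aeval (fun v => c v • (X v : MvPolynomial σ ℂ)) (monomial y a) =
        monomial y ((∏ v, c v ^ y v) * a) := by
      rw [aeval_monomial, Finsupp.prod_fintype _ _ fun _ => pow_zero _]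
      simp_rw [smul_pow, Finset.prod_smul, monomial_eq,
        Finsupp.prod_fintype y (fun v e => (X v : MvPolynomial σ ℂ) ^ e) fun _ => pow_zero _,
        smul_eq_C_mul, algebraMap_eq, C_mul]
      ring
    rw [h, coeff_monomial, coeff_monomial]
    split_ifs with hxy
    · rw [hxy]
    · simp
  | add p q hp hq => rw [map_add, coeff_add, coeff_add, hp, hq, mul_add]

theorem coeff_matAct_lensGen {n : ℕ} (k : ℕ) (s : Fin n → ℤ) (P : Rn n)
    (x : Fin n ⊕ Fin n →₀ ℕ) :
    coeff x (matAct n (lensGen n k s) P) =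
      xi k ^ (-Finsupp.weight (charge s) x) * coeff x P := by
  have hinv : (lensGen n k s)⁻¹ = Matrix.diagonal fun i => xi k ^ (-s i) := by
    refine Matrix.inv_eq_left_inv ?_
    rw [lensGen, Matrix.diagonal_mul_diagonal, ← Matrix.diagonal_one]
    congr 1
    ext i
    rw [← zpow_add₀ (xi_ne_zero k), neg_add_cancel, zpow_zero]
  have hact : matAct n (lensGen n k s) =
      aeval (fun v => xi k ^ (-charge s v) • (X v : Rn n)) := by
    rw [matAct, hinv]
    congr 1
    ext1 (i | i)
    · simp [Matrix.diagonal_apply, charge, ite_smul]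
    · simp [Matrix.diagonal_apply, charge, ite_smul, apply_ite, map_zpow₀, star_xi]
  rw [hact, coeff_aeval_smul_X]
  congr 1
  rw [Finsupp.weight_eq_sum, ← Finset.sum_neg_distrib]
  simp_rw [← zpow_natCast, ← _root_.zpow_mul]
  induction (Finset.univ : Finset (Fin n ⊕ Fin n)) using Finset.cons_induction with
  | empty => simp
  | cons a t ha ih =>
    rw [Finset.prod_cons, Finset.sum_cons, ih, zpow_add₀ (xi_ne_zero k)]
    congr 2
    simp [mul_comm]

theorem mem_fixedBy_lensGen {n k : ℕ} (hk : k ≠ 0) (s : Fin n → ℤ) (P : Rn n) :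
    P ∈ fixedBy n (lensGen n k s) ↔
      ∀ x ∈ P.support, (k : ℤ) ∣ Finsupp.weight (charge s) x := by
  simp only [fixedBy, LinearMap.mem_ker, LinearMap.sub_apply, sub_eq_zero, MvPolynomial.ext_iff,
    AlgHom.toLinearMap_apply, LinearMap.id_apply, coeff_matAct_lensGen, mem_support_iff]
  refine forall_congr' fun x => ?_
  rw [← dvd_neg, ← xi_zpow_eq_one_iff hk]
  by_cases h : coeff x P = 0 <;> simp [h]

theorem coe_lensGen_zpow {n k : ℕ} (s : Fin n → ℤ) (l : ℤ) :
    (((⟨lensGen n k s, lensGen_mem n k s⟩ : Matrix.unitaryGroup (Fin n) ℂ) ^ l :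
      Matrix.unitaryGroup (Fin n) ℂ) : Matrix (Fin n) (Fin n) ℂ) = lensGen n k (l • s) := by
  let f : Multiplicative ℤ →* Matrix.unitaryGroup (Fin n) ℂ :=
    MonoidHom.mk' (fun l => ⟨lensGen n k (l.toAdd • s), lensGen_mem n k _⟩) fun a b => by
      ext1
      simp [lensGen, add_mul, zpow_add₀ (xi_ne_zero k)]
  have h := congrArg Subtype.val (MonoidHom.apply_mint _ f (Multiplicative.ofAdd l))
  simpa [f] using h.symm

theorem HpqInv_lensSubgroup {n k : ℕ} (hk : k ≠ 0) (s : Fin n → ℤ) (p q : ℕ) :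
    HpqInv n p q (lensSubgroup n k s) =
      restrictSupport ℂ (invExponents n k s (p, q)) ⊓ LinearMap.ker (DeltaOp n) := by
  have hfix : (⨅ γ ∈ lensSubgroup n k s, fixedBy n ↑γ) = fixedBy n (lensGen n k s) := by
    refine le_antisymm (iInf₂_le (⟨lensGen n k s, lensGen_mem n k s⟩ : Matrix.unitaryGroup _ ℂ)
      (Subgroup.mem_zpowers _)) (le_iInf₂ fun γ hγ P hP => ?_)
    obtain ⟨l, rfl⟩ := Subgroup.mem_zpowers_iff.mp hγ
    rw [coe_lensGen_zpow, mem_fixedBy_lensGen hk]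
    intro x hx
    have h : Finsupp.weight (charge (l • s)) x = l * Finsupp.weight (charge s) x := by
      simp [weight_charge, mul_sub, Finset.mul_sum, mul_assoc]
    rw [h]
    exact ((mem_fixedBy_lensGen hk s P).mp hP x hx).mul_left l
  rw [HpqInv, Hpq, hfix, inf_right_comm]
  congr 1
  ext P
  rw [Submodule.mem_inf, mem_fixedBy_lensGen hk, mem_restrictSupport_iff, Ppq,
    mem_weightedHomogeneousSubmodule, IsWeightedHomogeneous]
  simp only [Set.subset_def, Finset.mem_coe, mem_support_iff, invExponents, Set.mem_ofPred_eq]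
  exact ⟨fun h x hx => ⟨h.1 hx, h.2 x hx⟩, fun h => ⟨fun x hx => (h x hx).1, fun x hx => (h x hx).2⟩⟩

/-- The exponent of `z_j z̄_j`. -/
def pairExponent {n : ℕ} (j : Fin n) : Fin n ⊕ Fin n →₀ ℕ :=
  Finsupp.single (Sum.inl j) 1 + Finsupp.single (Sum.inr j) 1

theorem add_pairExponent_mem_invExponents {n k : ℕ} (s : Fin n → ℤ) (j : Fin n)
    (x : Fin n ⊕ Fin n →₀ ℕ) (p q : ℕ) :
    x + pairExponent j ∈ invExponents n k s (p + 1, q + 1) ↔ x ∈ invExponents n k s (p, q) := by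
  simp [invExponents, pairExponent, Finsupp.weight_single, wt, charge, Prod.ext_iff]

theorem DeltaOp_monomial {n : ℕ} (x : Fin n ⊕ Fin n →₀ ℕ) :
    DeltaOp n (monomial x 1) = ∑ j, ((x (Sum.inl j) : ℂ) * x (Sum.inr j)) •
      monomial (x - pairExponent j) 1 := by
  simp only [DeltaOp, LinearMap.sum_apply, LinearMap.comp_apply, Derivation.coeFn_coe,
    pderiv_monomial, smul_monomial, tsub_tsub, pairExponent]
  refine Finset.sum_congr rfl fun j _ => ?_
  simp [add_comm, mul_comm]

theorem finrank_inf_ker_add_finrank_map {V W : Type*} [AddCommGroup V] [Module ℂ V]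
    [AddCommGroup W] [Module ℂ W] (f : V →ₗ[ℂ] W) (S : Submodule ℂ V) [FiniteDimensional ℂ S] :
    Module.finrank ℂ ↥(S ⊓ LinearMap.ker f) + Module.finrank ℂ (S.map f) =
      Module.finrank ℂ S := by
  rw [← LinearMap.finrank_range_add_finrank_ker (f.domRestrict S), LinearMap.range_domRestrict,
    LinearMap.ker_domRestrict, add_comm]
  congr 1
  rw [← Submodule.map_comap_subtype, Submodule.finrank_map_subtype_eq]

theorem finrank_restrictSupport_invExponents (n k : ℕ) (s : Fin n → ℤ) (d : ℕ × ℕ) :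
    Module.finrank ℂ (restrictSupport ℂ (invExponents n k s d)) =
      Nat.card (invExponents n k s d) :=
  Module.finrank_eq_nat_card_basis (basisRestrictSupport ℂ _)

theorem finiteDimensional_restrictSupport_invExponents (n k : ℕ) (s : Fin n → ℤ) (d : ℕ × ℕ) :
    FiniteDimensional ℂ (restrictSupport ℂ (invExponents n k s d)) :=
  have := (finite_invExponents n k s d).to_subtype
  (basisRestrictSupport ℂ _).finiteDimensional_of_finite

theorem sub_add_pairExponent {n : ℕ} {x : Fin n ⊕ Fin n →₀ ℕ} {j : Fin n}
    (hl : x (Sum.inl j) ≠ 0) (hr : x (Sum.inr j) ≠ 0) :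
    x - pairExponent j + pairExponent j = x := by
  classical
  refine tsub_add_cancel_of_le fun v => ?_
  rcases v with i | i <;> by_cases h : j = i
  all_goals simp [pairExponent, h]
  all_goals subst h; lia

theorem map_DeltaOp_restrictSupport {n k : ℕ} (hn : 0 < n) (s : Fin n → ℤ) (p q : ℕ) :
    (restrictSupport ℂ (invExponents n k s (p + 1, q + 1))).map (DeltaOp n) =
      restrictSupport ℂ (invExponents n k s (p, q)) := by
  refine le_antisymm ?_ ?_
  · rw [restrictSupport_eq_span, Submodule.map_span_le]
    rintro _ ⟨x, hx, rfl⟩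
    rw [DeltaOp_monomial]
    refine Submodule.sum_mem _ fun j _ => ?_
    by_cases hl : x (Sum.inl j) = 0
    · simp [hl]
    by_cases hr : x (Sum.inr j) = 0
    · simp [hr]
    refine Submodule.smul_mem _ _ ((monomial_mem_restrictSupport ℂ).mpr (Or.inl ?_))
    rwa [← add_pairExponent_mem_invExponents s j, sub_add_pairExponent hl hr]
  · rw [restrictSupport_eq_span ℂ (invExponents n k s (p, q)), Submodule.span_le]
    rintro _ ⟨x, hx, rfl⟩
    let i₀ : Fin n := ⟨0, hn⟩
    induction hN : p - x (Sum.inl i₀) using Nat.strong_induction_on generalizing x with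
    | _ N ih =>
    have hle : ∀ {y}, y ∈ invExponents n k s (p, q) → y (Sum.inl i₀) ≤ p := by
      rintro y ⟨hy, -⟩
      rw [weight_wt, Prod.mk.injEq] at hy
      rw [← hy.1]
      exact Finset.single_le_sum (f := fun i => y (Sum.inl i)) (fun _ _ => Nat.zero_le _)
        (Finset.mem_univ i₀)
    have hmem : DeltaOp n (monomial (x + pairExponent i₀) 1) ∈
        (restrictSupport ℂ (invExponents n k s (p + 1, q + 1))).map (DeltaOp n) :=
      Submodule.mem_map_of_mem ((monomial_mem_restrictSupport ℂ).mpr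
        (Or.inl ((add_pairExponent_mem_invExponents s i₀ x p q).mpr hx)))
    rw [DeltaOp_monomial, ← Finset.add_sum_erase _ _ (Finset.mem_univ i₀),
      Submodule.add_mem_iff_left] at hmem
    · rw [add_tsub_cancel_right] at hmem
      refine (Submodule.smul_mem_iff _ ?_).mp hmem
      simp [pairExponent, Nat.cast_add_one_ne_zero]
    · refine Submodule.sum_mem _ fun j hj => ?_
      have hj : j ≠ i₀ := Finset.ne_of_mem_erase hj
      by_cases hl : (x + pairExponent i₀) (Sum.inl j) = 0
      · simp [hl]
      by_cases hr : (x + pairExponent i₀) (Sum.inr j) = 0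
      · simp [hr]
      have hy : x + pairExponent i₀ - pairExponent j ∈ invExponents n k s (p, q) := by
        rwa [← add_pairExponent_mem_invExponents s j, sub_add_pairExponent hl hr,
          add_pairExponent_mem_invExponents]
      refine Submodule.smul_mem _ _ (ih _ ?_ _ hy rfl)
      have h1 : (x + pairExponent i₀ - pairExponent j) (Sum.inl i₀) = x (Sum.inl i₀) + 1 := by
        simp [pairExponent, hj]
      have h2 := hle hy
      lia

theorem restrictSupport_le_ker_DeltaOp {n k : ℕ} (s : Fin n → ℤ) {p q : ℕ}
    (h : p = 0 ∨ q = 0) :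
    restrictSupport ℂ (invExponents n k s (p, q)) ≤ LinearMap.ker (DeltaOp n) := by
  rw [restrictSupport_eq_span, Submodule.span_le]
  rintro _ ⟨x, ⟨hx, -⟩, rfl⟩
  rw [weight_wt, Prod.mk.injEq] at hx
  rw [SetLike.mem_coe, LinearMap.mem_ker, DeltaOp_monomial]
  refine Finset.sum_eq_zero fun j _ => ?_
  rcases h with rfl | rfl
  · simp [Finset.sum_eq_zero_iff.mp hx.1 j (Finset.mem_univ j)]
  · simp [Finset.sum_eq_zero_iff.mp hx.2 j (Finset.mem_univ j)]

theorem dInv_lensSubgroup_succ_add {n k : ℕ} (hk : k ≠ 0) (hn : 0 < n) (s : Fin n → ℤ)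
    (p q : ℕ) :
    dInv n (p + 1) (q + 1) (lensSubgroup n k s) + Nat.card (invExponents n k s (p, q)) =
      Nat.card (invExponents n k s (p + 1, q + 1)) := by
  have := finiteDimensional_restrictSupport_invExponents n k s (p + 1, q + 1)
  rw [dInv, HpqInv_lensSubgroup hk, ← finrank_restrictSupport_invExponents,
    ← map_DeltaOp_restrictSupport hn s p q, finrank_inf_ker_add_finrank_map,
    finrank_restrictSupport_invExponents]

theorem dInv_lensSubgroup_of_eq_zero {n k : ℕ} (hk : k ≠ 0) (s : Fin n → ℤ) {p q : ℕ}
    (h : p = 0 ∨ q = 0) :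
    dInv n p q (lensSubgroup n k s) = Nat.card (invExponents n k s (p, q)) := by
  rw [dInv, HpqInv_lensSubgroup hk, inf_eq_left.mpr (restrictSupport_le_ker_DeltaOp s h),
    finrank_restrictSupport_invExponents]

theorem hasSum_xi_zpow_charge {n k : ℕ} (hk : k ≠ 0) (s : Fin n → ℤ) (m : ℕ) {z w : ℂ}
    (hz : ‖z‖ < 1) (hw : ‖w‖ < 1) :
    HasSum (fun x : Fin n ⊕ Fin n →₀ ℕ => xi k ^ (Finsupp.weight (charge s) x * m) *
        (z ^ (Finsupp.weight (wt n) x).1 * w ^ (Finsupp.weight (wt n) x).2))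
      (∏ i, ((z - xi k ^ (-(s i) * m)) * (w - xi k ^ (s i * m))))⁻¹ := by
  have hgeom : ∀ (c : ℤ) {u : ℂ}, ‖u‖ < 1 →
      HasSum (fun a : ℕ => (xi k ^ c * u) ^ a) (1 - xi k ^ c * u)⁻¹ := fun c u hu =>
    hasSum_geometric_of_norm_lt_one (by rwa [norm_mul, norm_xi_zpow hk, one_mul])
  have hl := hasSum_pi_prod fun i => hgeom (s i * m) hz
  have hr := hasSum_pi_prod fun i => hgeom (-(s i) * m) hw
  have hprod := hasSum_mul_complex hl hr
  let e : (Fin n ⊕ Fin n →₀ ℕ) ≃ (Fin n → ℕ) × (Fin n → ℕ) :=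
    Finsupp.equivFunOnFinite.trans (Equiv.sumArrowEquivProdArrow _ _ _)
  rw [← e.hasSum_iff] at hprod
  convert! hprod using 1
  · ext x
    have hexp : ∀ (t : Fin n → ℤ) (a : Fin n → ℕ) (u : ℂ),
        ∏ i, (xi k ^ (t i * m) * u) ^ a i =
          xi k ^ ((∑ i, t i * a i) * m) * u ^ ∑ i, a i := by
      intro t a u
      simp_rw [mul_pow]
      rw [Finset.prod_mul_distrib, Finset.prod_pow_eq_pow_sum, Finset.sum_mul]
      congr 1
      induction (Finset.univ : Finset (Fin n)) using Finset.cons_induction with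
      | empty => simp
      | cons b t hb ih =>
        rw [Finset.prod_cons, Finset.sum_cons, ih, zpow_add₀ (xi_ne_zero k), ← zpow_natCast,
          ← _root_.zpow_mul, mul_right_comm]
    have hl' := hexp s (fun i => x (Sum.inl i)) z
    have hr' := hexp (fun i => -(s i)) (fun i => x (Sum.inr i)) w
    simp only [Function.comp_apply, e, Equiv.trans_apply, Finsupp.equivFunOnFinite_apply,
      Equiv.sumArrowEquivProdArrow_apply_fst, Equiv.sumArrowEquivProdArrow_apply_snd]
    rw [hl', hr', weight_charge, weight_wt, mul_mul_mul_comm, ← zpow_add₀ (xi_ne_zero k)]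
    congr 2
    simp only [neg_mul, Finset.sum_neg_distrib]
    ring
  · rw [← Finset.prod_mul_distrib, ← Finset.prod_inv_distrib]
    refine Finset.prod_congr rfl fun i _ => ?_
    rw [← mul_inv, neg_mul, _root_.zpow_neg]
    have h0 : xi k ^ (s i * m) ≠ 0 := zpow_ne_zero _ (xi_ne_zero k)
    congr 1
    field_simp
    ring

theorem hasSum_card_invExponents {n k : ℕ} (hk : k ≠ 0) (s : Fin n → ℤ) {z w : ℂ}
    (hz : ‖z‖ < 1) (hw : ‖w‖ < 1) :
    HasSum (fun d : ℕ × ℕ => (Nat.card (invExponents n k s d) : ℂ) * z ^ d.1 * w ^ d.2)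
      ((k : ℂ)⁻¹ * ∑ m ∈ Finset.range k,
        (∏ i, ((z - xi k ^ (-(s i) * m)) * (w - xi k ^ (s i * m))))⁻¹) := by
  have h := (hasSum_sum (s := Finset.range k) fun m _ =>
    hasSum_xi_zpow_charge hk s m hz hw).mul_left (k : ℂ)⁻¹
  simp_rw [← Finset.sum_mul, ← mul_assoc, sum_xi_zpow_mul hk] at h
  convert! h.tsum_fiberwise (Finsupp.weight (wt n)) using 2 with d
  have := (finite_invExponents n k s d).fintype
  have hsub := tsum_subtype (⇑(Finsupp.weight (R := ℕ) (wt n)) ⁻¹' {d}) fun x =>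
    (if (k : ℤ) ∣ Finsupp.weight (charge s) x then (1 : ℂ) else 0) *
      z ^ (Finsupp.weight (wt n) x).1 * w ^ (Finsupp.weight (wt n) x).2
  rw [hsub, ← tsum_congr (f := (invExponents n k s d).indicator
    fun _ => z ^ d.1 * w ^ d.2), ← tsum_subtype]
  · simp [tsum_fintype, mul_assoc]
  · intro x
    by_cases h1 : Finsupp.weight (wt n) x = d <;>
    by_cases h2 : (k : ℤ) ∣ Finsupp.weight (charge s) x <;>
    simp [Set.indicator, invExponents, h1, h2]

/-- **Generating function of a CR lens space** (Fan–Kim–Plzak–Shors–Sottile–Zeytuncu).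
For `|z|, |w| < 1`, `Σ_{p,q} dim ℋ_{p,q}^{Γ_{k,s}} z^p w^q` converges absolutely and equals
`(1/k) Σ_{m=0}^{k-1} (1-zw) / Π_i (z - ξ^{-s_i m})(w - ξ^{s_i m})`. -/
theorem lens_generating_function (k n : ℕ) (hk : 2 ≤ k) (hn : 1 ≤ n)
    (s : Fin n → ℤ) (hs : ∀ i, Int.gcd (s i) k = 1)
    (z w : ℂ) (hz : ‖z‖ < 1) (hw : ‖w‖ < 1) :
    Summable (fun pq : ℕ × ℕ =>
      ‖(dInv n pq.1 pq.2 (lensSubgroup n k s) : ℂ) * z ^ pq.1 * w ^ pq.2‖) ∧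
    HasSum (fun pq : ℕ × ℕ =>
        (dInv n pq.1 pq.2 (lensSubgroup n k s) : ℂ) * z ^ pq.1 * w ^ pq.2)
      ((k : ℂ)⁻¹ * ∑ m ∈ Finset.range k,
        (1 - z * w) / ∏ i, ((z - xi k ^ (-(s i) * m)) * (w - xi k ^ (s i * m)))) := by
  have hk0 : k ≠ 0 := by lia
  have hcard := hasSum_card_invExponents hk0 s hz hw
  have hshift : HasSum (fun d : ℕ × ℕ => ((Nat.card (invExponents n k s d) : ℂ) -
      dInv n d.1 d.2 (lensSubgroup n k s)) * z ^ d.1 * w ^ d.2)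
      (z * w * ((k : ℂ)⁻¹ * ∑ m ∈ Finset.range k,
        (∏ i, ((z - xi k ^ (-(s i) * m)) * (w - xi k ^ (s i * m))))⁻¹)) := by
    have hinj : Function.Injective fun d : ℕ × ℕ => (d.1 + 1, d.2 + 1) := by
      rintro ⟨a, b⟩ ⟨a', b'⟩ h
      simpa using h
    refine (hinj.hasSum_iff ?_).mp ?_
    · rintro ⟨p, q⟩ h
      have h0 : p = 0 ∨ q = 0 := by
        by_contra! h0
        exact h ⟨(p - 1, q - 1), by ext <;> simp <;> lia⟩
      simp [dInv_lensSubgroup_of_eq_zero hk0 s h0]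
    · convert! hcard.mul_left (z * w) using 1
      ext d
      simp only [Function.comp_apply, ← dInv_lensSubgroup_succ_add hk0 hn s d.1 d.2]
      push_cast
      ring
  have hsum : HasSum (fun d : ℕ × ℕ =>
      (dInv n d.1 d.2 (lensSubgroup n k s) : ℂ) * z ^ d.1 * w ^ d.2)
      ((k : ℂ)⁻¹ * ∑ m ∈ Finset.range k,
        (1 - z * w) / ∏ i, ((z - xi k ^ (-(s i) * m)) * (w - xi k ^ (s i * m)))) := by
    convert! hcard.sub hshift using 1
    · ext d
      ring
    · simp_rw [div_eq_mul_inv, ← Finset.mul_sum]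
      ring
  exact ⟨hsum.summable.norm, hsum⟩

end
end
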